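/- Preservation of quadratic invariants by stochastic partitioned Runge–Kutta methods (Theorem 4.1): Let s, M, d₁, d₂ be natural numbers, D a real d₁×d₂ matrix, and for each m ∈ {0,1,…,M} let g¹_m : ℝ^{d₂} → ℝ^{d₁} and g²_m : ℝ^{d₁} → ℝ^{d₂} be functions satisfying the invariance condition ⟨g¹_m(y), D y⟩ + ⟨x, D (g²_m(x))⟩ = 0 for all x ∈ ℝ^{d₁}, y ∈ ℝ^{d₂}. Let γ_i^{(q,m)}, Z_{ij}^{(q,m)} ∈ ℝ (i,j = 1,…,s; q ∈ {1,2}; m ∈ {0,…,M}) satisfy the quadratic-invariant coefficient condition γ_i^{(1,m₁)} γ_j^{(2,m₂)} = γ_j^{(2,m₂)} Z_{ji}^{(1,m₁)} + γ_i^{(1,m₁)} Z_{ij}^{(2,m₂)} for all i,j and all m₁,m₂ ∈ {0,…,M}, together with the consistency condition Σ_{i=1}^s γ_i^{(1,m)} = Σ_{i=1}^s γ_i^{(2,m)} for every m. Suppose Y₀¹ ∈ ℝ^{d₁}, Y₀² ∈ ℝ^{d₂}, and stage values H_i¹ ∈ ℝ^{d₁}, H_i² ∈ ℝ^{d₂}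 (i = 1,…,s) satisfy H_i¹ = Y₀¹ + Σ_{m=0}^M Σ_{j=1}^s Z_{ij}^{(1,m)} g¹_m(H_j²) and H_i² = Y₀² + Σ_{m=0}^M Σ_{j=1}^s Z_{ij}^{(2,m)} g²_m(H_j¹), and define Y₁¹ = Y₀¹ + Σ_{m=0}^M Σ_{i=1}^s γ_i^{(1,m)} g¹_m(H_i²) and Y₁² = Y₀² + Σ_{m=0}^M Σ_{i=1}^s γ_i^{(2,m)} g²_m(H_i¹). Then (Y₁¹)ᵀ D Y₁² = (Y₀¹)ᵀ D Y₀². -/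

import Mathlib

open BigOperators Matrix

/-- A bilinear form is unchanged when both arguments receive increments `∑ p, c p • a p` and
`∑ q, d q • b q`, provided each increment direction is orthogonal to the corresponding stage of the
other argument and the weights `c`, `d` are compatible with the stage coefficients `P`, `Q`. -/
theorem LinearMap.apply_add_sum_smul_add_sum_smul_eq {R V W α β : Type*} [CommRing R]
    [AddCommGroup V] [Module R V] [AddCommGroup W] [Module R W] [Fintype α] [Fintype β]
    (B : V →ₗ[R] W →ₗ[R] R) (x : V) (y : W) (a : α → V) (b : β → W) (c : α → R) (d : β → R)
    (P : β → α → R) (Q : α → β → R)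
    (hcd : ∀ p q, c p * d q = d q * P q p + c p * Q p q)
    (ha : ∀ p, B (a p) (y + ∑ q, Q p q • b q) = 0)
    (hb : ∀ q, B (x + ∑ p, P q p • a p) (b q) = 0) :
    B (x + ∑ p, c p • a p) (y + ∑ q, d q • b q) = B x y := by
  have hay : ∑ p, c p * B (a p) y = -∑ p, ∑ q, c p * Q p q * B (a p) (b q) := by
    rw [← Finset.sum_neg_distrib]
    refine Finset.sum_congr rfl fun p _ => ?_
    have h := ha p
    simp only [map_add, map_sum, map_smul, smul_eq_mul] at h
    rw [eq_neg_of_add_eq_zero_left h, mul_neg, Finset.mul_sum]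
    simp only [mul_assoc]
  have hxb : ∑ q, d q * B x (b q) = -∑ p, ∑ q, d q * P q p * B (a p) (b q) := by
    rw [Finset.sum_comm, ← Finset.sum_neg_distrib]
    refine Finset.sum_congr rfl fun q _ => ?_
    have h := hb q
    simp only [map_add, map_sum, map_smul, LinearMap.add_apply, LinearMap.sum_apply,
      LinearMap.smul_apply, smul_eq_mul] at h
    rw [eq_neg_of_add_eq_zero_left h, mul_neg, Finset.mul_sum]
    simp only [mul_assoc]
  have hab : ∑ q, d q * ∑ p, c p * B (a p) (b q) =
      ∑ p, ∑ q, d q * P q p * B (a p) (b q) + ∑ p, ∑ q, c p * Q p q * B (a p) (b q) := by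
    simp only [Finset.mul_sum, ← Finset.sum_add_distrib]
    rw [Finset.sum_comm]
    refine Finset.sum_congr rfl fun p _ => Finset.sum_congr rfl fun q _ => ?_
    linear_combination B (a p) (b q) * hcd p q
  simp only [map_add, map_sum, map_smul, LinearMap.add_apply, LinearMap.sum_apply,
    LinearMap.smul_apply, smul_eq_mul, mul_add, Finset.sum_add_distrib]
  rw [hay, hxb, hab]
  ring

/-- Theorem 4.1: a stochastic partitioned Runge-Kutta method whose coefficients satisfy
the quadratic-invariant condition
`γ^{(1,m₁)}_i γ^{(2,m₂)}_j = γ^{(2,m₂)}_j Z^{(1,m₁)}_{ji} + γ^{(1,m₁)}_i Z^{(2,m₂)}_{ij}`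
(together with the consistency condition `∑ᵢ γ^{(1,m)}_i = ∑ᵢ γ^{(2,m)}_i`) preserves
quadratic invariants `(X¹)ᵀ D X²` of separable two-partition systems, i.e. one step of
the method applied with coefficient functions `g¹_m`, `g²_m` satisfying
`⟨g¹_m(y), D y⟩ + ⟨x, D g²_m(x)⟩ = 0` leaves `(Y¹)ᵀ D Y²` unchanged. -/
theorem sprk_preserves_quadratic_invariants
    (s M d₁ d₂ : ℕ) (D : Matrix (Fin d₁) (Fin d₂) ℝ)
    (g₁ : Fin (M + 1) → (Fin d₂ → ℝ) → (Fin d₁ → ℝ))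
    (g₂ : Fin (M + 1) → (Fin d₁ → ℝ) → (Fin d₂ → ℝ))
    (hinv : ∀ (m : Fin (M + 1)) (x : Fin d₁ → ℝ) (y : Fin d₂ → ℝ),
      g₁ m y ⬝ᵥ (D *ᵥ y) + x ⬝ᵥ (D *ᵥ g₂ m x) = 0)
    (γ₁ γ₂ : Fin (M + 1) → Fin s → ℝ)
    (Z₁ Z₂ : Fin (M + 1) → Fin s → Fin s → ℝ)
    (hqi : ∀ (i j : Fin s) (m₁ m₂ : Fin (M + 1)),
      γ₁ m₁ i * γ₂ m₂ j = γ₂ m₂ j * Z₁ m₁ j i + γ₁ m₁ i * Z₂ m₂ i j)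
    (hcons : ∀ m : Fin (M + 1), ∑ i, γ₁ m i = ∑ i, γ₂ m i)
    (Y₀₁ : Fin d₁ → ℝ) (Y₀₂ : Fin d₂ → ℝ)
    (H₁ : Fin s → Fin d₁ → ℝ) (H₂ : Fin s → Fin d₂ → ℝ)
    (hH₁ : ∀ i, H₁ i = Y₀₁ + ∑ m, ∑ j, Z₁ m i j • g₁ m (H₂ j))
    (hH₂ : ∀ i, H₂ i = Y₀₂ + ∑ m, ∑ j, Z₂ m i j • g₂ m (H₁ j))
    (Y₁₁ : Fin d₁ → ℝ) (Y₁₂ : Fin d₂ → ℝ)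
    (hY₁₁ : Y₁₁ = Y₀₁ + ∑ m, ∑ i, γ₁ m i • g₁ m (H₂ i))
    (hY₁₂ : Y₁₂ = Y₀₂ + ∑ m, ∑ i, γ₂ m i • g₂ m (H₁ i)) :
    Y₁₁ ⬝ᵥ (D *ᵥ Y₁₂) = Y₀₁ ⬝ᵥ (D *ᵥ Y₀₂) := by
  have hg₁ : ∀ m y, g₁ m y ⬝ᵥ (D *ᵥ y) = 0 := fun m y => by simpa using hinv m 0 y
  have hg₂ : ∀ m x, x ⬝ᵥ (D *ᵥ g₂ m x) = 0 := fun m x => by simpa using hinv m x 0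
  have key := LinearMap.apply_add_sum_smul_add_sum_smul_eq (Matrix.toLinearMap₂' ℝ D) Y₀₁ Y₀₂
    (fun p : Fin (M + 1) × Fin s => g₁ p.1 (H₂ p.2))
    (fun q : Fin (M + 1) × Fin s => g₂ q.1 (H₁ q.2))
    (fun p => γ₁ p.1 p.2) (fun q => γ₂ q.1 q.2)
    (fun q p => Z₁ p.1 q.2 p.2) (fun p q => Z₂ q.1 p.2 q.2)
    (fun p q => hqi p.2 q.2 p.1 q.1)
  simp only [Fintype.sum_prod_type, Matrix.toLinearMap₂'_apply', ← hH₁, ← hH₂, ← hY₁₁,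
    ← hY₁₂] at key
  exact key (fun p => hg₁ p.1 _) (fun q => hg₂ q.1 _)
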